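/- (Stochastic-control expectation bound.) Assume σ satisfies hypothesis (H^σ_α), b satisfies hypothesis (H^b_0), and in addition b and σ are smooth in the space variable with bounded spatial derivatives of every order. Fix T > 0. Then there is a constant C > 0 depending only on Θ = (T,α,0,κ₀,κ₁,d) such that for every measurable ℓ : ℝ^d → (0,∞) with 0 < inf ℓ ≤ sup ℓ < ∞, every x ∈ ℝ^d, every (s,t) ∈ 𝔻^T_0 and every solution ℙ_{s,x} of the martingale problem for (b,σ) started at (s,x): E_{ℙ_{s,x}}[ℓ(X_t)] ≤ C·sup_{z∈ℝ^d} exp( ln ℓ(z) − C^{-1}·|z − θ^{(1)}_{t,s}(x)|² ). -/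

import Mathlib

noncomputable section

open MeasureTheory Matrix Set

/-- The state space `ℝ^d`. -/
abbrev Vec (d : ℕ) := EuclideanSpace ℝ (Fin d)

/-- Hypothesis (H^b_β): `b` is measurable, bounded at the origin uniformly in time
and Hölder/Lipschitz in space uniformly in time. -/
def HolderDrift (d : ℕ) (b : ℝ → Vec d → Vec d) (κ₁ β : ℝ) : Prop :=
  Measurable (Function.uncurry b) ∧
  (∀ t : ℝ, 0 ≤ t → ‖b t 0‖ ≤ κ₁) ∧
  (∀ t : ℝ, 0 ≤ t → ∀ x y : Vec d, ‖b t x - b t y‖ ≤ κ₁ * max (‖x - y‖ ^ β) ‖x - y‖)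

/-- A smooth nonnegative mollifier supported in the closed unit ball with total mass one. -/
structure IsMollifier (d : ℕ) (ρ : Vec d → ℝ) : Prop where
  smooth : ContDiff ℝ (⊤ : ℕ∞) ρ
  nonneg : ∀ x, 0 ≤ ρ x
  support_subset : Function.support ρ ⊆ Metric.closedBall 0 1
  integral_eq_one : ∫ x, ρ x = 1

/-- The spatially mollified drift `b_ε(t,x) = ∫ b(t,y) ρ_ε(x-y) dy`. -/
def mollifiedDrift (d : ℕ) (ρ : Vec d → ℝ) (ε : ℝ) (b : ℝ → Vec d → Vec d)
    (t : ℝ) (x : Vec d) : Vec d :=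
  ∫ y : Vec d, (ε ^ (-(d : ℝ)) * ρ (ε⁻¹ • (x - y))) • b t y

/-- `θ` is the flow of the (time-dependent) vector field `f`:
`θ t s x = x + ∫_s^t f(r, θ r s x) dr` for all nonnegative times. -/
def IsFlow (d : ℕ) (f : ℝ → Vec d → Vec d) (θ : ℝ → ℝ → Vec d → Vec d) : Prop :=
  ∀ s t : ℝ, 0 ≤ s → 0 ≤ t → ∀ x : Vec d,
    θ t s x = x + ∫ r in s..t, f r (θ r s x)

/-- The Gaussian kernel `g_λ(t,x) = t^{-d/2} exp(-λ |x|²/t)`. -/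
def gaussk (d : ℕ) (l t : ℝ) (x : Vec d) : ℝ :=
  t ^ (-(d : ℝ) / 2) * Real.exp (-l * ‖x‖ ^ 2 / t)

/-- A drift which is measurable, bounded at the origin uniformly in time, and Lipschitz in
space with constant `κ` uniformly in time. -/
def LipschitzDrift (d : ℕ) (b : ℝ → Vec d → Vec d) (κ : ℝ) : Prop :=
  Measurable (Function.uncurry b) ∧
  (∃ M : ℝ, ∀ t : ℝ, 0 ≤ t → ‖b t 0‖ ≤ M) ∧
  (∀ t : ℝ, 0 ≤ t → ∀ x y : Vec d, ‖b t x - b t y‖ ≤ κ * ‖x - y‖)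

/-- The diffusion matrix `σσ*`. -/
def sqMat (d : ℕ) (σ : ℝ → Vec d → Matrix (Fin d) (Fin d) ℝ) (t : ℝ) (x : Vec d) :
    Matrix (Fin d) (Fin d) ℝ :=
  σ t x * (σ t x)ᵀ

/-- Hypothesis (H^σ_α): measurability, uniform ellipticity with constant `κ₀`
and spatial α-Hölder continuity with constant `κ₀`. -/
def EllipticHolder (d : ℕ) (σ : ℝ → Vec d → Matrix (Fin d) (Fin d) ℝ) (κ₀ α : ℝ) : Prop :=
  (∀ i j : Fin d, Measurable fun p : ℝ × Vec d => σ p.1 p.2 i j) ∧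
  (∀ t : ℝ, 0 ≤ t → ∀ x : Vec d, ∀ ξ : Fin d → ℝ,
    κ₀⁻¹ * (ξ ⬝ᵥ ξ) ≤ (sqMat d σ t x).mulVec ξ ⬝ᵥ ξ ∧
      (sqMat d σ t x).mulVec ξ ⬝ᵥ ξ ≤ κ₀ * (ξ ⬝ᵥ ξ)) ∧
  (∀ t : ℝ, 0 ≤ t → ∀ x y : Vec d, ∀ i j : Fin d,
    |σ t x i j - σ t y i j| ≤ κ₀ * ‖x - y‖ ^ α)

/-- `b` is smooth in the space variable, with spatial derivatives of every order
bounded uniformly in time and space. -/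
def SmoothVecBounded (d : ℕ) (b : ℝ → Vec d → Vec d) : Prop :=
  (∀ t : ℝ, ContDiff ℝ (⊤ : ℕ∞) (b t)) ∧
  ∀ n : ℕ, 1 ≤ n → ∃ M : ℝ, ∀ t : ℝ, 0 ≤ t → ∀ x : Vec d,
    ‖iteratedFDeriv ℝ n (b t) x‖ ≤ M

/-- `σ` is smooth in the space variable, with spatial derivatives of every order
bounded uniformly in time and space. -/
def SmoothMatBounded (d : ℕ) (σ : ℝ → Vec d → Matrix (Fin d) (Fin d) ℝ) : Prop :=
  (∀ t : ℝ, ∀ i j : Fin d, ContDiff ℝ (⊤ : ℕ∞) fun x => σ t x i j) ∧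
  ∀ n : ℕ, 1 ≤ n → ∃ M : ℝ, ∀ t : ℝ, 0 ≤ t → ∀ x : Vec d, ∀ i j : Fin d,
    ‖iteratedFDeriv ℝ n (fun z => σ t z i j) x‖ ≤ M

/-- The mean shift `ϑ^{(τ,ξ)}_{t,s} = ∫_s^t b(r, θ_{r,τ}(ξ)) dr` of the frozen process. -/
def freezeMean (d : ℕ) (b : ℝ → Vec d → Vec d) (θ : ℝ → ℝ → Vec d → Vec d)
    (τ : ℝ) (ξ : Vec d) (s t : ℝ) : Vec d :=
  ∫ r in s..t, b r (θ r τ ξ)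

/-- The covariance `𝒞^{(τ,ξ)}_{t,s} = ∫_s^t (σσ*)(r, θ_{r,τ}(ξ)) dr` of the frozen process. -/
def freezeCov (d : ℕ) (σ : ℝ → Vec d → Matrix (Fin d) (Fin d) ℝ)
    (θ : ℝ → ℝ → Vec d → Vec d) (τ : ℝ) (ξ : Vec d) (s t : ℝ) :
    Matrix (Fin d) (Fin d) ℝ :=
  Matrix.of fun i j => ∫ r in s..t, sqMat d σ r (θ r τ ξ) i j

/-- The frozen Gaussian density
`p̃^{(τ,ξ)}(s,x,t,y) = ((2π)^d det 𝒞)^{-1/2} exp(−½ ⟨𝒞⁻¹ m, m⟩)`, `m = ϑ + x − y`. -/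
def frozenDensity (d : ℕ) (b : ℝ → Vec d → Vec d)
    (σ : ℝ → Vec d → Matrix (Fin d) (Fin d) ℝ) (θ : ℝ → ℝ → Vec d → Vec d)
    (τ : ℝ) (ξ : Vec d) (s : ℝ) (x : Vec d) (t : ℝ) (y : Vec d) : ℝ :=
  (Real.sqrt ((2 * Real.pi) ^ d * (freezeCov d σ θ τ ξ s t).det))⁻¹ *
    Real.exp (-(1 / 2) *
      ((freezeCov d σ θ τ ξ s t)⁻¹.mulVec (fun i => (freezeMean d b θ τ ξ s t + x - y) i) ⬝ᵥ
        fun i => (freezeMean d b θ τ ξ s t + x - y) i))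

/-- The generator `L_{r} f(z) = ⟨b(r,z), ∇f(z)⟩ + ½ tr(σσ*(r,z) ∇²f(z))`. -/
def genApply (d : ℕ) (b : ℝ → Vec d → Vec d)
    (σ : ℝ → Vec d → Matrix (Fin d) (Fin d) ℝ) (r : ℝ) (f : Vec d → ℝ) (z : Vec d) : ℝ :=
  (∑ i, b r z i * fderiv ℝ f z (EuclideanSpace.single i (1 : ℝ))) +
    (1 / 2) * ∑ i, ∑ j, sqMat d σ r z i j *
      iteratedFDeriv ℝ 2 f z
        ![EuclideanSpace.single i (1 : ℝ), EuclideanSpace.single j (1 : ℝ)]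

/-- The natural σ-algebra of the process `X` on the time interval `[s,u]`. -/
def pathSigma (d : ℕ) {Ω : Type*} [MeasurableSpace Ω] (X : ℝ → Ω → Vec d)
    (s u : ℝ) : MeasurableSpace Ω :=
  ⨆ r ∈ Set.Icc s u, MeasurableSpace.comap (X r) inferInstance

/-- A solution of the martingale problem for `(b,σ)` started at `(s,x)`:
a probability measure `P` together with a process `X` with continuous paths on `[s,∞)`,
`X_s = x` a.s., such that for every `f ∈ C_c^∞(ℝ^d)` the process
`t ↦ f(X_t) − ∫_s^t (L_r f)(X_r) dr` is a martingale w.r.t. the natural filtration. -/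
structure MartingaleProblemSolution (d : ℕ) (b : ℝ → Vec d → Vec d)
    (σ : ℝ → Vec d → Matrix (Fin d) (Fin d) ℝ) (s : ℝ) (x : Vec d)
    {Ω : Type*} [MeasurableSpace Ω] (P : MeasureTheory.Measure Ω)
    (X : ℝ → Ω → Vec d) : Prop where
  isProb : MeasureTheory.IsProbabilityMeasure P
  measurable_X : ∀ t : ℝ, Measurable (X t)
  cont_paths : ∀ ω : Ω, ContinuousOn (fun t => X t ω) (Set.Ici s)
  start : ∀ᵐ ω ∂P, X s ω = x
  integrable : ∀ f : Vec d → ℝ, ContDiff ℝ (⊤ : ℕ∞) f → HasCompactSupport f →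
    ∀ t : ℝ, s ≤ t →
      MeasureTheory.Integrable
        (fun ω => f (X t ω) - ∫ r in s..t, genApply d b σ r f (X r ω)) P
  martingale : ∀ f : Vec d → ℝ, ContDiff ℝ (⊤ : ℕ∞) f → HasCompactSupport f →
    ∀ u v : ℝ, s ≤ u → u ≤ v → ∀ A : Set Ω, MeasurableSet[pathSigma d X s u] A →
      ∫ ω in A, (f (X v ω) - ∫ r in s..v, genApply d b σ r f (X r ω)) ∂P =
      ∫ ω in A, (f (X u ω) - ∫ r in s..u, genApply d b σ r f (X r ω)) ∂P

open Filter Topology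

/-- The exponential, smoothly cut off to vanish on `[R, ∞)`. -/
def cutoffExpDeriv (R q : ℝ) : ℝ := Real.exp q * Real.smoothTransition (R - q)

/-- The primitive of `cutoffExpDeriv R` vanishing on `[R, ∞)`: up to an additive constant it is
the exponential on `(-∞, R - 1]`. -/
def cutoffExp (R p : ℝ) : ℝ := ∫ q in R..p, cutoffExpDeriv R q

lemma contDiff_cutoffExpDeriv (R : ℝ) : ContDiff ℝ (⊤ : ℕ∞) (cutoffExpDeriv R) := by
  unfold cutoffExpDeriv
  exact Real.contDiff_exp.mul (Real.smoothTransition.contDiff.comp (contDiff_const.sub contDiff_id))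

lemma hasDerivAt_cutoffExp (R p : ℝ) : HasDerivAt (cutoffExp R) (cutoffExpDeriv R p) p :=
  ((contDiff_cutoffExpDeriv R).continuous).deriv_integral _ R p ▸
    (intervalIntegral.integral_hasDerivAt_right
      ((contDiff_cutoffExpDeriv R).continuous.intervalIntegrable _ _)
      ((contDiff_cutoffExpDeriv R).continuous.stronglyMeasurableAtFilter _ _)
      (contDiff_cutoffExpDeriv R).continuous.continuousAt).differentiableAt.hasDerivAt

lemma contDiff_cutoffExp (R : ℝ) : ContDiff ℝ (⊤ : ℕ∞) (cutoffExp R) := by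
  rw [contDiff_infty_iff_deriv]
  refine ⟨fun p => (hasDerivAt_cutoffExp R p).differentiableAt, ?_⟩
  rw [show deriv (cutoffExp R) = cutoffExpDeriv R from funext fun p =>
    (hasDerivAt_cutoffExp R p).deriv]
  exact contDiff_cutoffExpDeriv R

lemma cutoffExpDeriv_nonneg (R q : ℝ) : 0 ≤ cutoffExpDeriv R q :=
  mul_nonneg (Real.exp_pos _).le (Real.smoothTransition.nonneg _)

lemma cutoffExpDeriv_le_exp (R q : ℝ) : cutoffExpDeriv R q ≤ Real.exp q :=
  mul_le_of_le_one_right (Real.exp_pos _).le (Real.smoothTransition.le_one _)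

lemma cutoffExpDeriv_eq_zero {R q : ℝ} (h : R ≤ q) : cutoffExpDeriv R q = 0 := by
  simp [cutoffExpDeriv, Real.smoothTransition.zero_of_nonpos (sub_nonpos.2 h)]

lemma cutoffExpDeriv_eq_exp {R q : ℝ} (h : q ≤ R - 1) : cutoffExpDeriv R q = Real.exp q := by
  simp [cutoffExpDeriv, Real.smoothTransition.one_of_one_le (show 1 ≤ R - q by linarith)]

lemma cutoffExpDeriv_mul_le {R q : ℝ} (hR : 0 ≤ R) (hq : 0 ≤ q) :
    cutoffExpDeriv R q * q ≤ Real.exp R * R := by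
  rcases le_total R q with h | h
  · rw [cutoffExpDeriv_eq_zero h, zero_mul]; positivity
  · exact mul_le_mul ((cutoffExpDeriv_le_exp R q).trans (Real.exp_le_exp.2 h)) h hq
      (Real.exp_pos _).le

lemma deriv_cutoffExpDeriv_le (R q : ℝ) : deriv (cutoffExpDeriv R) q ≤ cutoffExpDeriv R q := by
  have hd : DifferentiableAt ℝ Real.smoothTransition (R - q) :=
    (Real.smoothTransition.contDiff (n := 1)).differentiable (by norm_num) _
  have h1 : HasDerivAt (cutoffExpDeriv R) (Real.exp q * Real.smoothTransition (R - q) +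
      Real.exp q * (deriv Real.smoothTransition (R - q) * (-1))) q := by
    have h2 : HasDerivAt (fun q : ℝ => R - q) (-1) q := by
      simpa using (hasDerivAt_id q).const_sub R
    exact (Real.hasDerivAt_exp q).mul (hd.hasDerivAt.comp q h2)
  rw [h1.deriv]
  have h3 : 0 ≤ deriv Real.smoothTransition (R - q) :=
    Real.smoothTransition.monotone.deriv_nonneg
  have := mul_nonneg (Real.exp_pos q).le h3
  simp only [cutoffExpDeriv]
  linarith

lemma intervalIntegrable_cutoffExpDeriv (R a b : ℝ) :
    IntervalIntegrable (cutoffExpDeriv R) volume a b :=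
  (contDiff_cutoffExpDeriv R).continuous.intervalIntegrable _ _

lemma cutoffExp_sub (R p q : ℝ) :
    cutoffExp R q - cutoffExp R p = ∫ r in p..q, cutoffExpDeriv R r :=
  intervalIntegral.integral_interval_sub_left (intervalIntegrable_cutoffExpDeriv _ _ _)
    (intervalIntegrable_cutoffExpDeriv _ _ _)

lemma cutoffExp_monotone (R : ℝ) : Monotone (cutoffExp R) := by
  intro p q h
  rw [← sub_nonneg, cutoffExp_sub]
  exact intervalIntegral.integral_nonneg h fun r _ => cutoffExpDeriv_nonneg R r

lemma cutoffExp_eq_zero {R p : ℝ} (h : R ≤ p) : cutoffExp R p = 0 := by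
  rw [cutoffExp, intervalIntegral.integral_congr (g := fun _ => (0 : ℝ))]
  · simp
  · intro q hq
    rw [uIcc_of_le h] at hq
    exact cutoffExpDeriv_eq_zero hq.1

lemma cutoffExp_nonpos (R p : ℝ) : cutoffExp R p ≤ 0 := by
  rcases le_total R p with h | h
  · exact (cutoffExp_eq_zero h).le
  · exact (cutoffExp_monotone R h).trans (cutoffExp_eq_zero le_rfl).le

lemma abs_cutoffExp_le (R : ℝ) {p : ℝ} (hp : 0 ≤ p) : |cutoffExp R p| ≤ |cutoffExp R 0| := by
  rw [abs_of_nonpos (cutoffExp_nonpos _ _), abs_of_nonpos (cutoffExp_nonpos _ _)]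
  exact neg_le_neg (cutoffExp_monotone R hp)

lemma cutoffExp_sub_zero_le (R : ℝ) {p : ℝ} (hp : 0 ≤ p) :
    cutoffExp R p - cutoffExp R 0 + 1 ≤ Real.exp p := by
  rw [cutoffExp_sub]
  have : ∫ r in (0 : ℝ)..p, cutoffExpDeriv R r ≤ ∫ r in (0 : ℝ)..p, Real.exp r :=
    intervalIntegral.integral_mono_on hp (intervalIntegrable_cutoffExpDeriv _ _ _)
      (Real.continuous_exp.intervalIntegrable _ _) fun r _ => cutoffExpDeriv_le_exp R r
  rw [integral_exp, Real.exp_zero] at this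
  linarith

lemma cutoffExp_sub_zero_eq {R p : ℝ} (hp : 0 ≤ p) (h : p ≤ R - 1) :
    cutoffExp R p - cutoffExp R 0 + 1 = Real.exp p := by
  rw [cutoffExp_sub, intervalIntegral.integral_congr (g := Real.exp), integral_exp, Real.exp_zero]
  · ring
  · intro q hq
    rw [uIcc_of_le hp] at hq
    exact cutoffExpDeriv_eq_exp (hq.2.trans h)

lemma min_exp_le_cutoffExp {R p : ℝ} (hR : 1 ≤ R) (hp : 0 ≤ p) :
    min (Real.exp p) (Real.exp (R - 1)) ≤ cutoffExp R p - cutoffExp R 0 + 1 := by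
  rcases le_total p (R - 1) with h | h
  · exact (min_le_left _ _).trans (cutoffExp_sub_zero_eq hp h).ge
  · refine (min_le_right _ _).trans ?_
    rw [← cutoffExp_sub_zero_eq (sub_nonneg.2 hR) le_rfl]
    linarith [cutoffExp_monotone R h]

lemma sqMat_diag_le {d : ℕ} {σ : ℝ → Vec d → Matrix (Fin d) (Fin d) ℝ} {κ₀ α : ℝ}
    (hσ : EllipticHolder d σ κ₀ α) {r : ℝ} (hr : 0 ≤ r) (y : Vec d) (i : Fin d) :
    sqMat d σ r y i i ≤ κ₀ := by
  have := (hσ.2.1 r hr y (Pi.single i 1)).2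
  simpa using this

lemma abs_sqMat_le {d : ℕ} {σ : ℝ → Vec d → Matrix (Fin d) (Fin d) ℝ} {κ₀ α : ℝ}
    (hσ : EllipticHolder d σ κ₀ α) {r : ℝ} (hr : 0 ≤ r) (y : Vec d) (i j : Fin d) :
    |sqMat d σ r y i j| ≤ κ₀ := by
  have hi := sqMat_diag_le hσ hr y i
  have hj := sqMat_diag_le hσ hr y j
  simp only [sqMat, Matrix.mul_apply, Matrix.transpose_apply] at hi hj ⊢
  have h : ∀ a b : ℝ, |a * b| ≤ (a * a + b * b) / 2 := fun a b => by
    rw [abs_le]; constructor <;> nlinarith [sq_nonneg (a + b), sq_nonneg (a - b)]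
  calc |∑ k, σ r y i k * σ r y j k| ≤ ∑ k, |σ r y i k * σ r y j k| :=
        Finset.abs_sum_le_sum_abs _ _
    _ ≤ ∑ k, (σ r y i k * σ r y i k + σ r y j k * σ r y j k) / 2 :=
        Finset.sum_le_sum fun k _ => h _ _
    _ ≤ κ₀ := by rw [← Finset.sum_div, Finset.sum_add_distrib]; linarith

lemma measurable_sqMat {d : ℕ} {σ : ℝ → Vec d → Matrix (Fin d) (Fin d) ℝ} {κ₀ α : ℝ}
    (hσ : EllipticHolder d σ κ₀ α) (i j : Fin d) :
    Measurable fun p : ℝ × Vec d => sqMat d σ p.1 p.2 i j := by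
  simp only [sqMat, Matrix.mul_apply, Matrix.transpose_apply]
  exact Finset.measurable_sum _ fun k _ => (hσ.1 i k).mul (hσ.1 j k)

lemma norm_drift_sub_le {d : ℕ} {b : ℝ → Vec d → Vec d} {κ₁ : ℝ} (hκ₁ : 0 < κ₁)
    (hb : HolderDrift d b κ₁ 0) {r : ℝ} (hr : 0 ≤ r) (x y : Vec d) :
    ‖b r x - b r y‖ ≤ κ₁ * (1 + ‖x - y‖) := by
  refine (hb.2.2 r hr x y).trans (mul_le_mul_of_nonneg_left ?_ hκ₁.le)
  rw [Real.rpow_zero]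
  exact max_le (by linarith [norm_nonneg (x - y)]) (by linarith)

lemma norm_drift_le {d : ℕ} {b : ℝ → Vec d → Vec d} {κ₁ : ℝ} (hκ₁ : 0 < κ₁)
    (hb : HolderDrift d b κ₁ 0) {r : ℝ} (hr : 0 ≤ r) (x : Vec d) :
    ‖b r x‖ ≤ κ₁ * (2 + ‖x‖) := by
  have h1 := norm_drift_sub_le hκ₁ hb hr x 0
  rw [sub_zero] at h1
  have h2 := norm_le_norm_add_norm_sub' (b r x) (b r 0)
  have := hb.2.1 r hr
  linarith

lemma intervalIntegrable_genApply {d : ℕ} {b : ℝ → Vec d → Vec d}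
    {σ : ℝ → Vec d → Matrix (Fin d) (Fin d) ℝ} {κ₀ α κ₁ : ℝ}
    (hσ : EllipticHolder d σ κ₀ α) (hκ₁ : 0 < κ₁) (hb : HolderDrift d b κ₁ 0)
    {y : ℝ → Vec d} (hy : Continuous y) {f : Vec d → ℝ} (hf : ContDiff ℝ (⊤ : ℕ∞) f)
    {u v : ℝ} (hu : 0 ≤ u) (hv : 0 ≤ v) :
    IntervalIntegrable (fun r => genApply d b σ r f (y r)) volume u v := by
  have hmeas : Measurable fun r => (r, y r) := measurable_id.prodMk hy.measurable
  obtain ⟨C, hC⟩ := isCompact_uIcc.exists_bound_of_continuousOn (s := uIcc u v) hy.continuousOn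
  have hbound : ∀ {h : ℝ → ℝ} {B : ℝ}, Measurable h → (∀ r ∈ uIcc u v, |h r| ≤ B) →
      IntervalIntegrable h volume u v := by
    intro h B hm hB
    refine (intervalIntegrable_const (c := B)).mono_fun hm.aestronglyMeasurable ?_
    filter_upwards [ae_restrict_mem measurableSet_uIoc] with r hr
    exact (hB r (uIoc_subset_uIcc hr)).trans (le_abs_self B)
  have hpos : ∀ r ∈ uIcc u v, 0 ≤ r := fun r hr => (le_min hu hv).trans hr.1
  have hD : ∀ i, Continuous fun r => fderiv ℝ f (y r) (EuclideanSpace.single i (1 : ℝ)) := fun i =>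
    ((hf.continuous_fderiv (by simp)).comp hy).clm_apply continuous_const
  have hD2 : ∀ i j : Fin d, Continuous fun r => iteratedFDeriv ℝ 2 f (y r)
        ![EuclideanSpace.single i (1 : ℝ), EuclideanSpace.single j (1 : ℝ)] := fun i j => by
    have h2 : Continuous fun r => iteratedFDeriv ℝ 2 f (y r) :=
      (hf.continuous_iteratedFDeriv (m := 2) (WithTop.coe_le_coe.2 le_top)).comp hy
    exact (ContinuousMultilinearMap.apply ℝ (fun _ : Fin 2 => Vec d) ℝ
      ![EuclideanSpace.single i (1 : ℝ), EuclideanSpace.single j (1 : ℝ)]).continuous.comp h2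
  unfold genApply
  refine IntervalIntegrable.add ?_ (IntervalIntegrable.const_mul ?_ _)
  · have := IntervalIntegrable.sum (μ := volume) (a := u) (b := v) Finset.univ
      (f := fun i r => b r (y r) i * fderiv ℝ f (y r) (EuclideanSpace.single i (1 : ℝ)))
      fun i _ => by
        refine IntervalIntegrable.mul_continuousOn ?_ (hD i).continuousOn
        refine hbound (B := κ₁ * (2 + C)) ?_ fun r hr => ?_
        · have : Measurable fun r => b r (y r) := hb.1.comp hmeas
          exact (EuclideanSpace.proj (𝕜 := ℝ) i).continuous.measurable.comp this
        · refine (PiLp.norm_apply_le (b r (y r)) i).trans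
            ((norm_drift_le hκ₁ hb (hpos r hr) _).trans ?_)
          gcongr
          exact hC r hr
    simpa [Finset.sum_fn] using this
  · have := IntervalIntegrable.sum (μ := volume) (a := u) (b := v) Finset.univ
      (f := fun i r => ∑ j, sqMat d σ r (y r) i j * iteratedFDeriv ℝ 2 f (y r)
        ![EuclideanSpace.single i (1 : ℝ), EuclideanSpace.single j (1 : ℝ)])
      fun i _ => by
        have := IntervalIntegrable.sum (μ := volume) (a := u) (b := v) Finset.univ
          (f := fun j r => sqMat d σ r (y r) i j * iteratedFDeriv ℝ 2 f (y r)
            ![EuclideanSpace.single i (1 : ℝ), EuclideanSpace.single j (1 : ℝ)])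
          fun j _ => by
            refine IntervalIntegrable.mul_continuousOn ?_ (hD2 i j).continuousOn
            exact hbound ((measurable_sqMat hσ i j).comp hmeas)
              fun r hr => abs_sqMat_le hσ (hpos r hr) _ i j
        simpa [Finset.sum_fn] using this
    simpa [Finset.sum_fn] using this

lemma continuous_path {d : ℕ} {b : ℝ → Vec d → Vec d}
    {σ : ℝ → Vec d → Matrix (Fin d) (Fin d) ℝ} {s : ℝ} {x : Vec d} {Ω : Type*}
    [MeasurableSpace Ω] {P : Measure Ω} {X : ℝ → Ω → Vec d}
    (hX : MartingaleProblemSolution d b σ s x P X) (ω : Ω) :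
    Continuous fun r => X (max s r) ω :=
  (hX.cont_paths ω).comp_continuous (by fun_prop) fun r => le_max_left s r

/-- The increment of the expectation of a test function is the expected time integral of
the generator along the path. -/
lemma integral_sub_integral_eq_genApply {d : ℕ} {b : ℝ → Vec d → Vec d}
    {σ : ℝ → Vec d → Matrix (Fin d) (Fin d) ℝ} {κ₀ α κ₁ : ℝ}
    (hσ : EllipticHolder d σ κ₀ α) (hκ₁ : 0 < κ₁) (hb : HolderDrift d b κ₁ 0)
    {s : ℝ} (hs : 0 ≤ s) {x : Vec d} {Ω : Type*}
    [MeasurableSpace Ω] {P : Measure Ω} {X : ℝ → Ω → Vec d}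
    (hX : MartingaleProblemSolution d b σ s x P X) {f : Vec d → ℝ}
    (hf : ContDiff ℝ (⊤ : ℕ∞) f) (hfc : HasCompactSupport f) {u v : ℝ} (hu : s ≤ u) (huv : u ≤ v) :
    Integrable (fun ω => ∫ r in u..v, genApply d b σ r f (X (max s r) ω)) P ∧
    ∫ ω, f (X v ω) ∂P - ∫ ω, f (X u ω) ∂P =
      ∫ ω, (∫ r in u..v, genApply d b σ r f (X (max s r) ω)) ∂P := by
  have := hX.isProb
  have hfi : ∀ r, Integrable (fun ω => f (X r ω)) P := fun r => by
    obtain ⟨C, hC⟩ := hfc.exists_bound_of_continuous hf.continuous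
    exact Integrable.of_bound ((hf.continuous.measurable.comp (hX.measurable_X r)).aestronglyMeasurable)
      C (ae_of_all _ fun ω => hC _)
  have hclip : ∀ r, s ≤ r → ∀ ω, ∫ q in s..r, genApply d b σ q f (X q ω) =
      ∫ q in s..r, genApply d b σ q f (X (max s q) ω) := fun r hr ω => by
    refine intervalIntegral.integral_congr fun q hq => ?_
    rw [uIcc_of_le hr] at hq
    simp only [max_eq_right hq.1]
  have hgi : ∀ r, s ≤ r →
      Integrable (fun ω => ∫ q in s..r, genApply d b σ q f (X (max s q) ω)) P := fun r hr => by
    have := (hfi r).sub (hX.integrable f hf hfc r hr)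
    refine this.congr (ae_of_all _ fun ω => ?_)
    simp [← hclip r hr ω]
  have hsplit : ∀ ω, ∫ r in u..v, genApply d b σ r f (X (max s r) ω) =
      (∫ q in s..v, genApply d b σ q f (X (max s q) ω)) -
        ∫ q in s..u, genApply d b σ q f (X (max s q) ω) := fun ω =>
    (intervalIntegral.integral_interval_sub_left
      (intervalIntegrable_genApply hσ hκ₁ hb (continuous_path hX ω) hf hs (hs.trans (hu.trans huv)))
      (intervalIntegrable_genApply hσ hκ₁ hb (continuous_path hX ω) hf hs (hs.trans hu))).symm
  simp only [hsplit]
  refine ⟨(hgi v (hu.trans huv)).sub (hgi u hu), ?_⟩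
  have hm := hX.martingale f hf hfc u v hu huv univ MeasurableSet.univ
  simp only [Measure.restrict_univ, hclip v (hu.trans huv), hclip u hu] at hm
  rw [integral_sub (hfi _) (hgi v (hu.trans huv)), integral_sub (hfi _) (hgi u hu)] at hm
  rw [integral_sub (hgi v (hu.trans huv)) (hgi u hu)]
  linarith

/-- The derivative of `F` in its first variable. -/
def paramDeriv {d : ℕ} (F : (ℝ × Vec d) × Vec d → ℝ) (z : (ℝ × Vec d) × Vec d) :
    ℝ × Vec d →L[ℝ] ℝ :=
  (fderiv ℝ F z).comp (ContinuousLinearMap.inl ℝ (ℝ × Vec d) (Vec d))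

lemma continuous_paramDeriv {d : ℕ} {F : (ℝ × Vec d) × Vec d → ℝ}
    (hF : ContDiff ℝ (⊤ : ℕ∞) F) : Continuous (paramDeriv F) :=
  (hF.continuous_fderiv (by simp)).clm_comp continuous_const

lemma norm_param_sub_le {d : ℕ} {F : (ℝ × Vec d) × Vec d → ℝ}
    (hF : ContDiff ℝ (⊤ : ℕ∞) F) {L : ℝ} (hL : ∀ z, ‖paramDeriv F z‖ ≤ L)
    (p q : ℝ × Vec d) (y : Vec d) : |F (q, y) - F (p, y)| ≤ L * ‖q - p‖ := by
  have h : ∀ p, HasFDerivAt (fun p => F (p, y)) (paramDeriv F (p, y)) p := fun p =>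
    ((hF.differentiable (by simp)) (p, y)).hasFDerivAt.comp p (hasFDerivAt_prodMk_left p y)
  exact convex_univ.norm_image_sub_le_of_norm_hasFDerivWithin_le
    (fun p _ => (h p).hasFDerivWithinAt) (fun p _ => hL _) (mem_univ p) (mem_univ q)

/-- First-order Taylor expansion in the parameter along curves, with the parameter curve
Lipschitz at the base point. -/
lemma tendsto_taylor_remainder {d : ℕ} {F : (ℝ × Vec d) × Vec d → ℝ}
    (hF : ContDiff ℝ (⊤ : ℕ∞) F) {q : ℝ → ℝ × Vec d} {y : ℝ → Vec d} {u t B : ℝ} (hut : u < t)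
    (hq : ∀ v ∈ Icc u t, ‖q v - q u‖ ≤ B * (v - u)) (hy : Continuous y) :
    Tendsto (fun v => |F (q v, y v) - F (q u, y v) - paramDeriv F (q u, y u) (q v - q u)| / (v - u))
      (𝓝[>] u) (𝓝 0) := by
  have hev : ∀ᶠ v in 𝓝[>] u, v ∈ Ioc u t := Ioc_mem_nhdsGT hut
  have hqO : (fun v => q v - q u) =O[𝓝[>] u] fun v => v - u := by
    refine Asymptotics.IsBigO.of_bound B ?_
    filter_upwards [hev] with v hv
    rw [Real.norm_of_nonneg (sub_nonneg.2 hv.1.le)]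
    exact hq v ⟨hv.1.le, hv.2⟩
  have hsub : Tendsto (fun v : ℝ => v - u) (𝓝[>] u) (𝓝 0) := by
    have : Tendsto (fun v : ℝ => v - u) (𝓝 u) (𝓝 (u - u)) := (continuous_sub_right u).tendsto u
    rw [sub_self] at this
    exact this.mono_left nhdsWithin_le_nhds
  have hqt : Tendsto q (𝓝[>] u) (𝓝 (q u)) := by
    have := hqO.trans_tendsto hsub
    simpa using this.add_const (q u)
  have hyt : Tendsto y (𝓝[>] u) (𝓝 (y u)) := (hy.tendsto u).mono_left nhdsWithin_le_nhds
  have hstr : HasStrictFDerivAt F (fderiv ℝ F (q u, y u)) (q u, y u) :=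
    hF.contDiffAt.hasStrictFDerivAt (by simp)
  have hlim : Tendsto (fun v => ((q v, y v), (q u, y v))) (𝓝[>] u)
      (𝓝 ((q u, y u), (q u, y u))) :=
    (hqt.prodMk_nhds hyt).prodMk_nhds (tendsto_const_nhds.prodMk_nhds hyt)
  have ho := hstr.isLittleO.comp_tendsto hlim
  have ho2 : (fun v => F (q v, y v) - F (q u, y v) - paramDeriv F (q u, y u) (q v - q u))
      =o[𝓝[>] u] fun v => v - u := by
    have hO : (fun v => (q v, y v) - (q u, y v)) =O[𝓝[>] u] fun v => v - u := by
      refine Asymptotics.IsBigO.trans (Asymptotics.IsBigO.of_bound 1 ?_) hqO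
      filter_upwards with v
      simp [Prod.norm_def]
    refine (ho.trans_isBigO hO).congr_left fun v => ?_
    simp [paramDeriv, -map_sub]
  have := ho2.norm_left.tendsto_div_nhds_zero
  simpa using this

lemma tendsto_average_zero {h : ℝ → ℝ} (hh : Continuous h) {u : ℝ} (h0 : h u = 0) :
    Tendsto (fun v => (∫ r in u..v, h r) / (v - u)) (𝓝[>] u) (𝓝 0) := by
  have hd : HasDerivAt (fun v => ∫ r in u..v, h r) 0 u := by
    rw [← h0]
    exact intervalIntegral.integral_hasDerivAt_right (hh.intervalIntegrable _ _)
      (hh.stronglyMeasurableAtFilter _ _) hh.continuousAt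
  have := (hasDerivAt_iff_tendsto_slope.1 hd).mono_left
    (nhdsWithin_mono u fun v (hv : v ∈ Ioi u) => ne_of_gt hv)
  refine this.congr fun v => ?_
  simp [slope_def_field]

lemma stronglyMeasurable_intervalIntegral {Ω : Type*} [MeasurableSpace Ω] {h : ℝ → Ω → ℝ}
    (hc : ∀ ω, Continuous fun r => h r ω) (hm : ∀ r, StronglyMeasurable (h r)) {u v : ℝ}
    (huv : u ≤ v) : StronglyMeasurable fun ω => ∫ r in u..v, h r ω := by
  have h1 : StronglyMeasurable (Function.uncurry h) :=
    stronglyMeasurable_uncurry_of_continuous_of_stronglyMeasurable hc hm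
  have h2 : StronglyMeasurable (Function.uncurry fun ω r => h r ω) :=
    h1.comp_measurable measurable_swap
  simp only [intervalIntegral.integral_of_le huv]
  exact h2.integral_prod_right (ν := volume.restrict (Ioc u v))

set_option maxHeartbeats 800000 in
/-- If `F` is a supersolution of the backward equation along the parameter curve
`r ↦ (r, θ r)`, then the expectation of `F ((r, θ r), X r)` does not increase. -/
lemma integral_le_of_supersolution {d : ℕ} {b : ℝ → Vec d → Vec d}
    {σ : ℝ → Vec d → Matrix (Fin d) (Fin d) ℝ} {κ₀ α κ₁ : ℝ}
    (hσ : EllipticHolder d σ κ₀ α) (hκ₁ : 0 < κ₁) (hb : HolderDrift d b κ₁ 0)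
    {s t : ℝ} (hs : 0 ≤ s) (hst : s < t) {x : Vec d} {Ω : Type*}
    [MeasurableSpace Ω] {P : Measure Ω} {X : ℝ → Ω → Vec d}
    (hX : MartingaleProblemSolution d b σ s x P X)
    {F : (ℝ × Vec d) × Vec d → ℝ} (hF : ContDiff ℝ (⊤ : ℕ∞) F)
    (hFc : ∀ q, HasCompactSupport fun y => F (q, y)) {M : ℝ} (hM : ∀ z, |F z| ≤ M)
    {L : ℝ} (hL : ∀ z, ‖paramDeriv F z‖ ≤ L)
    {θ c : ℝ → Vec d} {B : ℝ} (hB : ∀ r ∈ Icc s t, ‖c r‖ ≤ B)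
    (hc : IntervalIntegrable c volume s t)
    (hθ : ∀ u v, s ≤ u → u ≤ v → v ≤ t → θ v - θ u = ∫ r in u..v, c r)
    (hsub : ∀ u ∈ Ico s t, ∀ᶠ v in 𝓝[>] u, ∀ r ∈ Icc u v, ∀ y,
      paramDeriv F ((u, θ u), y) (1, c r) + genApply d b σ r (fun y => F ((u, θ u), y)) y ≤ 0) :
    ∫ ω, F ((t, θ t), X t ω) ∂P ≤ ∫ ω, F ((s, θ s), X s ω) ∂P := by
  have := hX.isProb
  have hB0 : 0 ≤ B := (norm_nonneg _).trans (hB s ⟨le_rfl, hst.le⟩)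
  have hL0 : 0 ≤ L := (norm_nonneg _).trans (hL 0)
  set Z : ℝ → Ω → Vec d := fun r ω => X (max s r) ω with hZ
  have hZc : ∀ ω, Continuous fun r => Z r ω := continuous_path hX
  have hZm : ∀ r, Measurable (Z r) := fun r => hX.measurable_X _
  have hZX : ∀ r, s ≤ r → Z r = X r := fun r hr => by simp [hZ, max_eq_right hr]
  set q : ℝ → ℝ × Vec d := fun r => (r, θ r) with hq
  have hθL : ∀ u v, s ≤ u → u ≤ v → v ≤ t → ‖θ v - θ u‖ ≤ B * (v - u) := by
    intro u v hu huv hv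
    rw [hθ u v hu huv hv]
    have := intervalIntegral.norm_integral_le_of_norm_le_const (a := u) (b := v) (f := c) (C := B)
      fun r hr => by
        rw [uIoc_of_le huv] at hr
        exact hB r ⟨hu.trans hr.1.le, hr.2.trans hv⟩
    rwa [abs_of_nonneg (sub_nonneg.2 huv)] at this
  have hqL : ∀ u v, s ≤ u → u ≤ v → v ≤ t → ‖q v - q u‖ ≤ (1 + B) * (v - u) := by
    intro u v hu huv hv
    have h1 := hθL u v hu huv hv
    have h2 : 0 ≤ v - u := sub_nonneg.2 huv
    simp only [hq, Prod.mk_sub_mk, Prod.norm_mk, Real.norm_of_nonneg h2]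
    refine max_le ?_ (h1.trans ?_) <;> nlinarith
  have hqc : ContinuousOn q (Icc s t) := by
    have : LipschitzOnWith (1 + B).toNNReal q (Icc s t) := by
      refine LipschitzOnWith.of_dist_le_mul fun v hv u hu => ?_
      rw [Real.coe_toNNReal _ (by linarith), dist_eq_norm, Real.dist_eq]
      rcases le_total u v with h | h
      · rw [abs_of_nonneg (sub_nonneg.2 h)]; exact hqL u v hu.1 h hv.2
      · rw [norm_sub_rev, abs_sub_comm, abs_of_nonneg (sub_nonneg.2 h)]
        exact hqL v u hv.1 h hu.2
    exact this.continuousOn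
  have hFm : ∀ p r, Measurable fun ω => F (p, Z r ω) := fun p r =>
    hF.continuous.measurable.comp (measurable_const.prodMk (hZm r))
  have hFi : ∀ p r, Integrable (fun ω => F (p, Z r ω)) P := fun p r =>
    Integrable.of_bound (hFm p r).aestronglyMeasurable M (ae_of_all _ fun ω => hM _)
  have key : ∀ ⦃v⦄, v ∈ Icc s t →
      ∫ ω, F (q v, Z v ω) ∂P ≤ (fun _ => ∫ ω, F (q s, Z s ω) ∂P) v := by
    refine image_le_of_liminf_slope_right_le_deriv_boundary (B' := fun _ => 0) ?_ le_rfl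
      continuousOn_const (fun _ _ => hasDerivWithinAt_const _ _ _) ?_
    · refine continuousOn_of_dominated (bound := fun _ => M)
        (fun v _ => (hFm _ _).aestronglyMeasurable) (fun v _ => ae_of_all _ fun ω => hM _)
        (integrable_const M) (ae_of_all _ fun ω => ?_)
      exact hF.continuous.comp_continuousOn (hqc.prodMk (hZc ω).continuousOn)
    intro u hu ε hε
    set D : Vec d → (ℝ × Vec d →L[ℝ] ℝ) := fun y => paramDeriv F (q u, y) with hD
    have hDc : Continuous D := (continuous_paramDeriv hF).comp (by fun_prop)
    set R₁ : ℝ → Ω → ℝ := fun v ω =>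
      |F (q v, Z v ω) - F (q u, Z v ω) - D (Z u ω) (q v - q u)| / (v - u) with hR₁
    set R₂ : ℝ → Ω → ℝ := fun v ω =>
      (∫ r in u..v, ‖D (Z u ω) - D (Z r ω)‖) / (v - u) with hR₂
    have hev : ∀ᶠ v in 𝓝[>] u, v ∈ Ioc u t := Ioc_mem_nhdsGT hu.2
    have hDm : ∀ r, StronglyMeasurable fun ω => D (Z r ω) := fun r =>
      hDc.comp_stronglyMeasurable (hZm r).stronglyMeasurable
    have hR₁m : ∀ v, AEStronglyMeasurable (R₁ v) P := fun v => by
      have h1 : StronglyMeasurable fun ω => D (Z u ω) (q v - q u) :=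
        (ContinuousLinearMap.apply ℝ ℝ (q v - q u)).continuous.comp_stronglyMeasurable (hDm u)
      have h2 := (((hFm (q v) v).sub (hFm (q u) v)).sub h1.measurable)
      exact ((measurable_norm.comp h2).div_const _).aestronglyMeasurable
    have hR₂m : ∀ v, u ≤ v → AEStronglyMeasurable (R₂ v) P := fun v hv => by
      have h1 : StronglyMeasurable fun ω => ∫ r in u..v, ‖D (Z u ω) - D (Z r ω)‖ :=
        stronglyMeasurable_intervalIntegral
          (fun ω => (continuous_const.sub (hDc.comp (hZc ω))).norm)
          (fun r => ((hDm u).sub (hDm r)).norm) hv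
      exact (h1.measurable.div_const _).aestronglyMeasurable
    have hR₁b : ∀ v ∈ Ioc u t, ∀ ω, ‖R₁ v ω‖ ≤ 2 * L * (1 + B) := fun v hv ω => by
      have h0 : 0 < v - u := sub_pos.2 hv.1
      have h1 := norm_param_sub_le hF hL (q u) (q v) (Z v ω)
      have h2 := (D (Z u ω)).le_of_opNorm_le (hL (q u, Z u ω)) (q v - q u)
      have h3 := hqL u v hu.1 hv.1.le hv.2
      rw [Real.norm_of_nonneg (by positivity), hR₁]
      rw [div_le_iff₀ h0]
      rw [Real.norm_eq_abs] at h2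
      refine (abs_sub _ _).trans ?_
      nlinarith [mul_le_mul_of_nonneg_left h3 hL0]
    have hDb : ∀ y, ‖D y‖ ≤ L := fun y => hL _
    have hR₂b : ∀ v ∈ Ioc u t, ∀ ω, ‖R₂ v ω‖ ≤ 2 * L := fun v hv ω => by
      have h0 : 0 < v - u := sub_pos.2 hv.1
      rw [hR₂, norm_div, Real.norm_of_nonneg h0.le, div_le_iff₀ h0]
      have := intervalIntegral.norm_integral_le_of_norm_le_const (a := u) (b := v)
        (f := fun r => ‖D (Z u ω) - D (Z r ω)‖) (C := 2 * L) fun r _ => by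
          rw [norm_norm]
          refine (norm_sub_le _ _).trans ?_
          linarith [hDb (Z u ω), hDb (Z r ω)]
      rwa [abs_of_nonneg h0.le] at this
    have hlim : Tendsto (fun v => ∫ ω, (R₁ v ω + (1 + B) * R₂ v ω) ∂P) (𝓝[>] u) (𝓝 0) := by
      have h := tendsto_integral_filter_of_dominated_convergence (μ := P) (l := 𝓝[>] u)
        (F := fun v ω => R₁ v ω + (1 + B) * R₂ v ω) (f := fun _ => 0)
        (fun _ => 2 * L * (1 + B) + (1 + B) * (2 * L)) ?_ ?_ (integrable_const _)
        (ae_of_all _ fun ω => ?_)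
      · simpa using h
      · filter_upwards [hev] with v hv
        exact (hR₁m v).add ((hR₂m v hv.1.le).const_mul _)
      · filter_upwards [hev] with v hv
        refine ae_of_all _ fun ω => (norm_add_le _ _).trans (add_le_add (hR₁b v hv ω) ?_)
        rw [norm_mul, Real.norm_of_nonneg (by linarith : (0 : ℝ) ≤ 1 + B)]
        exact mul_le_mul_of_nonneg_left (hR₂b v hv ω) (by linarith)
      · have h1 := tendsto_taylor_remainder hF hu.2 (q := q) (y := fun r => Z r ω) (B := 1 + B)
          (fun v hv => hqL u v hu.1 hv.1 hv.2) (hZc ω)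
        have h2 := tendsto_average_zero (u := u) (h := fun r => ‖D (Z u ω) - D (Z r ω)‖)
          (continuous_const.sub (hDc.comp (hZc ω))).norm (by simp)
        simpa only [mul_zero, add_zero] using h1.add (h2.const_mul (1 + B))
    refine Eventually.frequently ?_
    filter_upwards [hev, hsub u hu, hlim.eventually_lt_const hε] with v hv hsv hvε
    have h0 : 0 < v - u := sub_pos.2 hv.1
    refine lt_of_le_of_lt ?_ hvε
    rw [slope_def_field, div_le_iff₀ h0, mul_comm, ← integral_const_mul]
    obtain ⟨hgi, hge⟩ := integral_sub_integral_eq_genApply hσ hκ₁ hb hs hX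
      (f := fun y => F (q u, y)) (hF.comp (contDiff_prodMk_right _)) (hFc _) hu.1 hv.1.le
    rw [← hZX u hu.1, ← hZX v (hu.1.trans hv.1.le)] at hge
    have hRi : Integrable (fun ω => R₁ v ω + (1 + B) * R₂ v ω) P :=
      (Integrable.of_bound (hR₁m v) _ (ae_of_all _ (hR₁b v hv))).add
        ((Integrable.of_bound (hR₂m v hv.1.le) _ (ae_of_all _ (hR₂b v hv))).const_mul _)
    calc ∫ ω, F (q v, Z v ω) ∂P - ∫ ω, F (q u, Z u ω) ∂P
        = ∫ ω, ((F (q v, Z v ω) - F (q u, Z v ω)) +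
            ∫ r in u..v, genApply d b σ r (fun y => F (q u, y)) (Z r ω)) ∂P := by
          have hd : Integrable (fun ω => F (q v, Z v ω) - F (q u, Z v ω)) P :=
            (hFi _ _).sub (hFi _ _)
          refine Eq.trans ?_ (integral_add hd hgi).symm
          rw [← hge, integral_sub (hFi _ _) (hFi _ _)]
          ring
      _ ≤ ∫ ω, (v - u) * (R₁ v ω + (1 + B) * R₂ v ω) ∂P := by
          refine integral_mono (((hFi _ _).sub (hFi _ _)).add hgi) (hRi.const_mul _) fun ω => ?_
          have hcu : IntervalIntegrable c volume u v := hc.mono_set (by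
            rw [uIcc_of_le hv.1.le, uIcc_of_le hst.le]; exact Icc_subset_Icc hu.1 hv.2)
          have hcp : IntervalIntegrable (fun r => ((1 : ℝ), c r)) volume u v := by
            rw [intervalIntegrable_iff] at hcu ⊢
            exact (intervalIntegrable_iff.1 (intervalIntegrable_const (c := (1 : ℝ)))).prodMk hcu
          have hDq : D (Z u ω) (q v - q u) = ∫ r in u..v, D (Z u ω) (1, c r) := by
            rw [ContinuousLinearMap.intervalIntegral_comp_comm _ hcp]
            congr 1
            have e1 : (∫ r in u..v, ((1 : ℝ), c r)).1 = v - u := by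
              have := (ContinuousLinearMap.fst ℝ ℝ (Vec d)).intervalIntegral_comp_comm hcp
              simpa using this.symm
            have e2 : (∫ r in u..v, ((1 : ℝ), c r)).2 = ∫ r in u..v, c r := by
              have := (ContinuousLinearMap.snd ℝ ℝ (Vec d)).intervalIntegral_comp_comm hcp
              simpa using this.symm
            refine Prod.ext ?_ ?_
            · rw [e1]; rfl
            · rw [e2, ← hθ u v hu.1 hv.1.le hv.2]; rfl
          have hgI := intervalIntegrable_genApply hσ hκ₁ hb (hZc ω)
            (f := fun y => F (q u, y)) (hF.comp (contDiff_prodMk_right _)) (hs.trans hu.1)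
            (hs.trans (hu.1.trans hv.1.le))
          have hDI : IntervalIntegrable (fun r => D (Z u ω) (1, c r)) volume u v := by
            rw [intervalIntegrable_iff] at hcp ⊢
            exact (D (Z u ω)).integrable_comp hcp
          have hN : Continuous fun r => ‖D (Z u ω) - D (Z r ω)‖ :=
            (continuous_const.sub (hDc.comp (hZc ω))).norm
          have hmono : (∫ r in u..v, genApply d b σ r (fun y => F (q u, y)) (Z r ω)) +
              D (Z u ω) (q v - q u) ≤ (1 + B) * ∫ r in u..v, ‖D (Z u ω) - D (Z r ω)‖ := by
            rw [hDq, ← intervalIntegral.integral_add hgI hDI,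
              ← intervalIntegral.integral_const_mul]
            refine intervalIntegral.integral_mono_on hv.1.le (hgI.add hDI)
              ((hN.intervalIntegrable _ _).const_mul _) fun r hr => ?_
            have h1 := hsv r hr (Z r ω)
            have h2 := (D (Z u ω) - D (Z r ω)).le_opNorm (1, c r)
            have h3 : ‖((1 : ℝ), c r)‖ ≤ 1 + B := by
              have := hB r ⟨hu.1.trans hr.1, hr.2.trans hv.2⟩
              rw [Prod.norm_mk, norm_one]
              exact max_le (by linarith) (by linarith)
            have h4 := (le_abs_self _).trans (h2.trans (mul_le_mul_of_nonneg_left h3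
              (norm_nonneg (D (Z u ω) - D (Z r ω)))))
            rw [_root_.sub_apply] at h4
            have h5 : D (Z r ω) (1, c r) + genApply d b σ r (fun y => F (q u, y)) (Z r ω) ≤ 0 := h1
            linarith
          have e1 : (v - u) * R₁ v ω =
              |F (q v, Z v ω) - F (q u, Z v ω) - D (Z u ω) (q v - q u)| := by
            rw [hR₁]; field_simp
          have e2 : (v - u) * R₂ v ω = ∫ r in u..v, ‖D (Z u ω) - D (Z r ω)‖ := by
            rw [hR₂]; field_simp
          have h6 := le_abs_self (F (q v, Z v ω) - F (q u, Z v ω) - D (Z u ω) (q v - q u))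
          have e3 : (v - u) * (R₁ v ω + (1 + B) * R₂ v ω) =
              (v - u) * R₁ v ω + (1 + B) * ((v - u) * R₂ v ω) := by ring
          rw [e3, e1, e2]
          linarith
  have := key ⟨hst.le, le_rfl⟩
  rwa [hZX s le_rfl, hZX t hst.le] at this

/-- The exponent `exp (-K (τ - s)) (|y - ζ|² + 1)` at the point `((τ, ζ), y)`. -/
def barrierExponent (d : ℕ) (K s : ℝ) (z : (ℝ × Vec d) × Vec d) : ℝ :=
  Real.exp (-K * (z.1.1 - s)) * (‖z.2 - z.1.2‖ ^ 2 + 1)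

/-- The truncated Gaussian barrier. -/
def barrier (d : ℕ) (K s R : ℝ) (z : (ℝ × Vec d) × Vec d) : ℝ :=
  cutoffExp R (barrierExponent d K s z)

lemma barrierExponent_pos (d : ℕ) (K s : ℝ) (z : (ℝ × Vec d) × Vec d) :
    0 < barrierExponent d K s z := by
  unfold barrierExponent; positivity

lemma contDiff_barrier (d : ℕ) (K s R : ℝ) : ContDiff ℝ (⊤ : ℕ∞) (barrier d K s R) := by
  refine (contDiff_cutoffExp R).comp ?_
  unfold barrierExponent
  refine ContDiff.mul (Real.contDiff_exp.comp ?_)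
    (ContDiff.add (ContDiff.norm_sq ℝ ?_) contDiff_const)
  all_goals fun_prop

lemma hasCompactSupport_barrier (d : ℕ) (K s R : ℝ) (q : ℝ × Vec d) :
    HasCompactSupport fun y => barrier d K s R (q, y) := by
  refine HasCompactSupport.intro (isCompact_closedBall q.2 (|R| * Real.exp (K * (q.1 - s)) + 1))
    fun y hy => cutoffExp_eq_zero ?_
  rw [Metric.mem_closedBall, dist_eq_norm, not_le] at hy
  unfold barrierExponent
  have h1 : 0 ≤ |R| * Real.exp (K * (q.1 - s)) := by positivity
  have h2 : |R| * Real.exp (K * (q.1 - s)) ≤ ‖y - q.2‖ ^ 2 + 1 := by nlinarith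
  have h3 := mul_le_mul_of_nonneg_left h2 (Real.exp_pos (-K * (q.1 - s))).le
  have h4 : Real.exp (-K * (q.1 - s)) * (|R| * Real.exp (K * (q.1 - s))) = |R| := by
    rw [mul_left_comm, ← Real.exp_add]; simp
  rw [h4] at h3
  exact (le_abs_self R).trans h3

lemma paramDeriv_barrier {d : ℕ} (K s R : ℝ) (z : (ℝ × Vec d) × Vec d) (a : ℝ) (w : Vec d) :
    paramDeriv (barrier d K s R) z (a, w) = cutoffExpDeriv R (barrierExponent d K s z) *
      (Real.exp (-K * (z.1.1 - s)) *
        (-K * a * (‖z.2 - z.1.2‖ ^ 2 + 1) - 2 * inner ℝ (z.2 - z.1.2) w)) := by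
  have hline : HasDerivAt (fun r : ℝ => z + r • (((a, w), 0) : (ℝ × Vec d) × Vec d))
      ((a, w), 0) 0 := by
    simpa using ((hasDerivAt_id (0 : ℝ)).smul_const (((a, w), 0) : (ℝ × Vec d) × Vec d)).const_add z
  have h0 : z + (0 : ℝ) • (((a, w), 0) : (ℝ × Vec d) × Vec d) = z := by simp
  have h1 : HasDerivAt (fun r : ℝ => barrier d K s R (z + r • ((a, w), 0)))
      (paramDeriv (barrier d K s R) z (a, w)) 0 := by
    have h := (((contDiff_barrier d K s R).differentiable (by simp)) z).hasFDerivAt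
    rw [← h0] at h
    have := h.comp_hasDerivAt (0 : ℝ) hline
    rw [h0] at this
    exact this
  have h2 : HasDerivAt (fun r : ℝ => z.2 - (z.1.2 + r • w)) (-w) 0 := by
    simpa using (((hasDerivAt_id (0 : ℝ)).smul_const w).const_add z.1.2).const_sub z.2
  have h3 : HasDerivAt (fun r : ℝ => Real.exp (-K * (z.1.1 + r * a - s)))
      (Real.exp (-K * (z.1.1 - s)) * (-K * a)) 0 := by
    have : HasDerivAt (fun r : ℝ => -K * (z.1.1 + r * a - s)) (-K * a) 0 := by
      simpa using ((((hasDerivAt_id (0 : ℝ)).mul_const a).const_add z.1.1).sub_const s).const_mul (-K)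
    simpa using this.exp
  have h4 := h3.mul (h2.norm_sq.add_const 1)
  have heq : (fun r : ℝ => barrierExponent d K s (z + r • ((a, w), 0))) =ᶠ[𝓝 0]
      (fun r : ℝ => Real.exp (-K * (z.1.1 + r * a - s))) *
        fun r : ℝ => ‖z.2 - (z.1.2 + r • w)‖ ^ 2 + 1 :=
    Eventually.of_forall fun r => by simp [barrierExponent]
  have h5 := h4.congr_of_eventuallyEq heq
  have h6 := (hasDerivAt_cutoffExp R _).comp (0 : ℝ) h5
  refine h1.unique (h6.congr_deriv ?_)
  simp only [zero_smul, add_zero, zero_mul, inner_neg_right]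
  ring

lemma norm_paramDeriv_barrier_le {d : ℕ} {K s R : ℝ} (hK : 0 ≤ K) (hR : 0 ≤ R)
    (z : (ℝ × Vec d) × Vec d) :
    ‖paramDeriv (barrier d K s R) z‖ ≤ Real.exp R * R * (K + 2) := by
  refine ContinuousLinearMap.opNorm_le_bound _ (by positivity) fun p => ?_
  obtain ⟨a, w⟩ := p
  rw [paramDeriv_barrier]
  set N := ‖z.2 - z.1.2‖ with hN
  have hP : barrierExponent d K s z = Real.exp (-K * (z.1.1 - s)) * (N ^ 2 + 1) := rfl
  have h1 := cutoffExpDeriv_mul_le hR (barrierExponent_pos d K s z).le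
  have ha : |a| ≤ ‖(a, w)‖ := norm_fst_le (a, w)
  have hw : ‖w‖ ≤ ‖(a, w)‖ := norm_snd_le (a, w)
  have hin := abs_real_inner_le_norm (z.2 - z.1.2) w
  have hN0 : 0 ≤ N := norm_nonneg _
  have hb : |-K * a * (N ^ 2 + 1) - 2 * inner ℝ (z.2 - z.1.2) w| ≤
      (N ^ 2 + 1) * ((K + 2) * ‖(a, w)‖) := by
    refine (abs_sub _ _).trans ?_
    rw [abs_mul, abs_mul, abs_neg, abs_of_nonneg hK, abs_mul, abs_two,
      abs_of_nonneg (by positivity : 0 ≤ N ^ 2 + 1)]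
    have e1 : K * |a| * (N ^ 2 + 1) ≤ K * ‖(a, w)‖ * (N ^ 2 + 1) := by gcongr
    have e2 : N * ‖w‖ ≤ (N ^ 2 + 1) * ‖(a, w)‖ :=
      mul_le_mul (by nlinarith [sq_nonneg (N - 1)]) hw (norm_nonneg _) (by positivity)
    nlinarith
  rw [norm_mul, Real.norm_of_nonneg (cutoffExpDeriv_nonneg _ _), norm_mul,
    Real.norm_of_nonneg (Real.exp_pos _).le, Real.norm_eq_abs]
  calc _ ≤ cutoffExpDeriv R (barrierExponent d K s z) *
        (Real.exp (-K * (z.1.1 - s)) * ((N ^ 2 + 1) * ((K + 2) * ‖(a, w)‖))) := by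
        gcongr
        exact cutoffExpDeriv_nonneg _ _
    _ = (cutoffExpDeriv R (barrierExponent d K s z) * barrierExponent d K s z) *
          ((K + 2) * ‖(a, w)‖) := by rw [hP]; ring
    _ ≤ Real.exp R * R * ((K + 2) * ‖(a, w)‖) := by gcongr
    _ = _ := by ring

lemma hasFDerivAt_barrier_space {d : ℕ} (K s R : ℝ) (q : ℝ × Vec d) (y : Vec d) :
    HasFDerivAt (fun y => barrier d K s R (q, y))
      (cutoffExpDeriv R (barrierExponent d K s (q, y)) •
        ((2 * Real.exp (-K * (q.1 - s))) • innerSL ℝ (y - q.2))) y := by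
  have h1 : HasFDerivAt (fun y : Vec d => ‖y - q.2‖ ^ 2) (2 • innerSL ℝ (y - q.2)) y := by
    have := (hasFDerivAt_id y |>.sub_const q.2).norm_sq
    simpa using this
  have h2 : HasFDerivAt (fun y : Vec d => barrierExponent d K s (q, y)) _ y :=
    (h1.add_const 1).const_mul (Real.exp (-K * (q.1 - s)))
  have h3 := (hasDerivAt_cutoffExp R (barrierExponent d K s (q, y))).comp_hasFDerivAt y h2
  refine h3.congr_fderiv ?_
  ext w
  simp only [_root_.smul_apply, nsmul_eq_mul, smul_eq_mul]
  ring

lemma iteratedFDeriv_two_barrier_space {d : ℕ} (K s R : ℝ) (q : ℝ × Vec d) (y v w : Vec d) :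
    iteratedFDeriv ℝ 2 (fun y => barrier d K s R (q, y)) y ![v, w] =
      deriv (cutoffExpDeriv R) (barrierExponent d K s (q, y)) *
        (2 * Real.exp (-K * (q.1 - s))) ^ 2 * (inner ℝ (y - q.2) v * inner ℝ (y - q.2) w) +
      cutoffExpDeriv R (barrierExponent d K s (q, y)) *
        (2 * Real.exp (-K * (q.1 - s)) * inner ℝ v w) := by
  rw [iteratedFDeriv_two_apply]
  have hf : fderiv ℝ (fun y => barrier d K s R (q, y)) = fun y =>
      cutoffExpDeriv R (barrierExponent d K s (q, y)) •
        ((2 * Real.exp (-K * (q.1 - s))) • innerSL ℝ (y - q.2)) :=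
    funext fun y => (hasFDerivAt_barrier_space K s R q y).fderiv
  have h1 : HasFDerivAt (fun y : Vec d => ‖y - q.2‖ ^ 2) (2 • innerSL ℝ (y - q.2)) y := by
    have := (hasFDerivAt_id y |>.sub_const q.2).norm_sq
    simpa using this
  have h2 : HasFDerivAt (fun y : Vec d => barrierExponent d K s (q, y)) _ y :=
    (h1.add_const 1).const_mul (Real.exp (-K * (q.1 - s)))
  have h3 := (((contDiff_cutoffExpDeriv R).differentiable (by simp))
    (barrierExponent d K s (q, y))).hasDerivAt.comp_hasFDerivAt y h2
  have h4 : HasFDerivAt (fun y : Vec d =>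
      (2 * Real.exp (-K * (q.1 - s))) • innerSL ℝ (y - q.2)) _ y :=
    ((innerSL ℝ (E := Vec d)).hasFDerivAt.comp y ((hasFDerivAt_id y).sub_const q.2)).const_smul
      (2 * Real.exp (-K * (q.1 - s)))
  have h5 := h3.smul h4
  rw [hf]
  have h6 := h5.fderiv
  simp only [Function.comp_def] at h6
  simp only [Matrix.cons_val_zero, Matrix.cons_val_one]
  erw [h6]
  simp
  rw [innerSL_apply_apply, inner_sub_left, inner_sub_left]
  ring

lemma genApply_barrier {d : ℕ} (b : ℝ → Vec d → Vec d)
    (σ : ℝ → Vec d → Matrix (Fin d) (Fin d) ℝ) (r K s R : ℝ) (q : ℝ × Vec d) (y : Vec d) :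
    genApply d b σ r (fun y => barrier d K s R (q, y)) y =
      cutoffExpDeriv R (barrierExponent d K s (q, y)) *
          (2 * Real.exp (-K * (q.1 - s)) * inner ℝ (y - q.2) (b r y)) +
        (1 / 2) * (deriv (cutoffExpDeriv R) (barrierExponent d K s (q, y)) *
            (2 * Real.exp (-K * (q.1 - s))) ^ 2 *
            ((sqMat d σ r y).mulVec (fun i => (y - q.2) i) ⬝ᵥ fun i => (y - q.2) i) +
          cutoffExpDeriv R (barrierExponent d K s (q, y)) *
            (2 * Real.exp (-K * (q.1 - s)) * (sqMat d σ r y).trace)) := by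
  unfold genApply
  congr 1
  · rw [(hasFDerivAt_barrier_space K s R q y).fderiv, PiLp.inner_apply, Finset.mul_sum,
      Finset.mul_sum]
    refine Finset.sum_congr rfl fun i _ => ?_
    simp only [_root_.smul_apply, smul_eq_mul, innerSL_apply_apply,
      EuclideanSpace.inner_single_right]
    simp
    ring
  · congr 1
    simp only [iteratedFDeriv_two_barrier_space, EuclideanSpace.inner_single_right, mul_add,
      Finset.sum_add_distrib]
    congr 1
    · simp only [Matrix.mulVec, dotProduct, Finset.mul_sum, Finset.sum_mul]
      refine Finset.sum_congr rfl fun i _ => Finset.sum_congr rfl fun j _ => ?_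
      simp
      ring
    · simp only [Matrix.trace, Matrix.diag, Finset.mul_sum]
      refine Finset.sum_congr rfl fun i _ => ?_
      rw [Finset.sum_eq_single i]
      · simp
        ring
      · intro j _ hj
        simp [hj]
      · simp

lemma barrier_supersolution {d : ℕ} {b : ℝ → Vec d → Vec d}
    {σ : ℝ → Vec d → Matrix (Fin d) (Fin d) ℝ} {κ₀ κ₁ α r s R : ℝ} (hκ₀ : 0 ≤ κ₀) (hκ₁ : 0 ≤ κ₁)
    (hσ : EllipticHolder d σ κ₀ α) (hr : 0 ≤ r) {q : ℝ × Vec d} (hq : s ≤ q.1) {y c : Vec d}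
    (hc : ‖b r y - c‖ ≤ κ₁ * (4 + ‖y - q.2‖)) :
    paramDeriv (barrier d (6 * κ₁ + d * κ₀ + 2 * κ₀) s R) (q, y) (1, c) +
      genApply d b σ r (fun y => barrier d (6 * κ₁ + d * κ₀ + 2 * κ₀) s R (q, y)) y ≤ 0 := by
  rw [paramDeriv_barrier, genApply_barrier]
  set K := 6 * κ₁ + d * κ₀ + 2 * κ₀ with hK
  set φ := cutoffExpDeriv R (barrierExponent d K s (q, y))
  set φ' := deriv (cutoffExpDeriv R) (barrierExponent d K s (q, y))
  set e := Real.exp (-K * (q.1 - s))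
  set A := (sqMat d σ r y).mulVec (fun i => (y - q.2) i) ⬝ᵥ fun i => (y - q.2) i with hA
  have hK0 : 0 ≤ K := by positivity
  have hφ : 0 ≤ φ := cutoffExpDeriv_nonneg _ _
  have hφ' : φ' ≤ φ := deriv_cutoffExpDeriv_le _ _
  have he : 0 < e := Real.exp_pos _
  have he1 : e ≤ 1 := Real.exp_le_one_iff.2 (by nlinarith)
  have hN2 : (fun i => (y - q.2) i) ⬝ᵥ (fun i => (y - q.2) i) = ‖y - q.2‖ ^ 2 := by
    rw [EuclideanSpace.real_norm_sq_eq]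
    simp [dotProduct, sq]
  have hA1 := hσ.2.1 r hr y fun i => (y - q.2) i
  rw [hN2, ← hA] at hA1
  have hA0 : 0 ≤ A := le_trans (by positivity) hA1.1
  have htr : (sqMat d σ r y).trace ≤ d * κ₀ := by
    have := Finset.sum_le_card_nsmul Finset.univ (fun i => sqMat d σ r y i i) κ₀
      fun i _ => sqMat_diag_le hσ hr y i
    simpa [Matrix.trace] using this
  have hin : inner ℝ (y - q.2) (b r y) - inner ℝ (y - q.2) c ≤
      ‖y - q.2‖ * (κ₁ * (4 + ‖y - q.2‖)) := by
    rw [← inner_sub_right]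
    exact (real_inner_le_norm _ _).trans (by gcongr)
  generalize (sqMat d σ r y).trace = τ at *
  generalize inner ℝ (y - q.2) (b r y) = B at *
  change φ * (e * (-K * 1 * (‖y - q.2‖ ^ 2 + 1) - 2 * inner ℝ (y - q.2) c)) + _ ≤ 0
  generalize inner ℝ (y - q.2) c = D at *
  have hN : 0 ≤ ‖y - q.2‖ := norm_nonneg _
  generalize ‖y - q.2‖ = N at *
  have h1 : φ' * (2 * e) ^ 2 * A ≤ φ * e * (4 * κ₀ * N ^ 2) := by
    calc φ' * (2 * e) ^ 2 * A ≤ φ * (2 * e) ^ 2 * A := by gcongr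
      _ = φ * e * (4 * e * A) := by ring
      _ ≤ φ * e * (4 * 1 * (κ₀ * N ^ 2)) := by gcongr; exact hA1.2
      _ = _ := by ring
  have h2 : -K * (N ^ 2 + 1) + 2 * (B - D) + 2 * κ₀ * N ^ 2 + τ ≤ 0 := by
    have : 8 * N ≤ 4 * N ^ 2 + 4 := by nlinarith [sq_nonneg (N - 1)]
    have h3 := mul_le_mul_of_nonneg_left this hκ₁
    have h4 : 0 ≤ d * κ₀ * N ^ 2 := by positivity
    rw [hK]
    nlinarith
  have h3 := mul_nonpos_of_nonneg_of_nonpos (mul_nonneg hφ he.le) h2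
  nlinarith

lemma measurable_mollifiedDrift {d : ℕ} {b : ℝ → Vec d → Vec d} {ρ : Vec d → ℝ}
    (hb : Measurable (Function.uncurry b)) (hρ : IsMollifier d ρ) (ε : ℝ) :
    Measurable (Function.uncurry (mollifiedDrift d ρ ε b)) := by
  have hρm : Measurable ρ := hρ.smooth.continuous.measurable
  have hb' : Measurable fun p : (ℝ × Vec d) × Vec d => b p.1.1 p.2 :=
    hb.comp (measurable_fst.fst.prodMk measurable_snd)
  have h : Measurable fun p : (ℝ × Vec d) × Vec d =>
      (ε ^ (-(d : ℝ)) * ρ (ε⁻¹ • (p.1.2 - p.2))) • b p.1.1 p.2 := by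
    refine Measurable.smul (Measurable.const_mul (hρm.comp ?_) _) hb'
    fun_prop
  exact (StronglyMeasurable.integral_prod_right (ν := volume)
    (f := fun (q : ℝ × Vec d) y => (ε ^ (-(d : ℝ)) * ρ (ε⁻¹ • (q.2 - y))) • b q.1 y)
    h.stronglyMeasurable).measurable

lemma norm_mollifiedDrift_sub_le {d : ℕ} {b : ℝ → Vec d → Vec d} {ρ : Vec d → ℝ} {κ₁ : ℝ}
    (hκ₁ : 0 < κ₁) (hb : HolderDrift d b κ₁ 0) (hρ : IsMollifier d ρ) {r : ℝ} (hr : 0 ≤ r)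
    (hbc : Continuous (b r)) (z : Vec d) :
    ‖mollifiedDrift d ρ 1 b r z - b r z‖ ≤ 2 * κ₁ := by
  have hρs : HasCompactSupport ρ :=
    HasCompactSupport.intro (isCompact_closedBall (0 : Vec d) 1) fun y hy => by
      by_contra h
      exact hy (hρ.support_subset h)
  have hsupp : HasCompactSupport fun y => ρ (z - y) :=
    hρs.comp_homeomorph (Homeomorph.subLeft z)
  have hc : Continuous fun y => ρ (z - y) := hρ.smooth.continuous.comp (by fun_prop)
  have hint : Integrable fun y => ρ (z - y) := hc.integrable_of_hasCompactSupport hsupp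
  have hint2 : Integrable fun y => ρ (z - y) • b r y :=
    (hc.smul hbc).integrable_of_hasCompactSupport hsupp.smul_right
  have hone : ∫ y, ρ (z - y) = 1 := by
    rw [integral_sub_left_eq_self ρ volume z]
    exact hρ.integral_eq_one
  have hz : b r z = ∫ y, ρ (z - y) • b r z := by
    rw [integral_smul_const, hone, one_smul]
  have hm : mollifiedDrift d ρ 1 b r z = ∫ y, ρ (z - y) • b r y := by
    simp [mollifiedDrift]
  rw [hm, hz, ← integral_sub hint2 (hint.smul_const _)]
  calc _ ≤ ∫ y, ρ (z - y) * (2 * κ₁) := by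
        refine norm_integral_le_of_norm_le (hint.mul_const _) (Eventually.of_forall fun y => ?_)
        rw [← smul_sub, norm_smul, Real.norm_of_nonneg (hρ.nonneg _)]
        rcases eq_or_ne (ρ (z - y)) 0 with h0 | h0
        · simp [h0]
        · have h1 := hρ.support_subset h0
          rw [mem_closedBall_zero_iff, norm_sub_rev] at h1
          refine mul_le_mul_of_nonneg_left ?_ (hρ.nonneg _)
          refine (norm_drift_sub_le hκ₁ hb hr y z).trans ?_
          nlinarith
    _ = 2 * κ₁ := by rw [integral_mul_const, hone, one_mul]

/-- A solution of an integral equation with a field of linear growth obeys a Grönwall bound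
as long as the field is integrable along it. -/
lemma norm_le_of_integral_equation {E : Type*} [NormedAddCommGroup E] [NormedSpace ℝ E]
    {g θ : ℝ → E} {x : E} {s w κ m : ℝ} (hκ : 0 ≤ κ) (hm : 0 ≤ m)
    (hg : ∀ r ∈ Icc s w, ‖g r‖ ≤ κ * (m + ‖θ r‖))
    (hθc : ContinuousOn θ (Icc s w)) (hθ : ∀ r ∈ Icc s w, θ r = x + ∫ q in s..r, g q)
    {v : ℝ} (hv : v ∈ Icc s w) :
    ‖θ v‖ ≤ ‖x‖ + κ * gronwallBound 0 κ (m + ‖x‖) (v - s) := by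
  have hsw : s ≤ w := hv.1.trans hv.2
  set η : ℝ → E := fun r => θ (max s (min r w)) with hη
  have hηc : Continuous η := hθc.comp_continuous (by fun_prop)
    fun r => ⟨le_max_left _ _, max_le hsw (min_le_right _ _)⟩
  have hηθ : ∀ r ∈ Icc s w, η r = θ r := fun r hr => by
    simp [hη, min_eq_left hr.2, max_eq_right hr.1]
  have hcont : Continuous fun r => m + ‖η r‖ := by fun_prop
  set F : ℝ → ℝ := fun r => ∫ q in s..r, (m + ‖η q‖) with hF
  have hF' : ∀ r, HasDerivAt F (m + ‖η r‖) r := fun r =>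
    (hcont.integral_hasStrictDerivAt s r).hasDerivAt
  have hF0 : ∀ r ∈ Icc s w, 0 ≤ F r := fun r hr =>
    intervalIntegral.integral_nonneg hr.1 fun q _ => by positivity
  have hθF : ∀ r ∈ Icc s w, ‖θ r‖ ≤ ‖x‖ + κ * F r := fun r hr => by
    rw [hθ r hr]
    refine (norm_add_le _ _).trans (add_le_add_right ?_ _)
    rw [hF, ← intervalIntegral.integral_const_mul]
    refine intervalIntegral.norm_integral_le_of_norm_le hr.1 (Eventually.of_forall fun q hq => ?_)
      ((hcont.const_mul κ).intervalIntegrable _ _)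
    have hq' : q ∈ Icc s w := ⟨hq.1.le, hq.2.trans hr.2⟩
    rw [hηθ q hq']
    exact hg q hq'
  have hgr := norm_le_gronwallBound_of_norm_deriv_right_le (f := F) (δ := 0) (K := κ)
    (ε := m + ‖x‖) (a := s) (b := w) (fun r _ => (hF' r).continuousAt.continuousWithinAt)
    (fun r _ => (hF' r).hasDerivWithinAt) (by simp [hF])
    (fun r hr => by
      have hr' : r ∈ Icc s w := ⟨hr.1, hr.2.le⟩
      rw [Real.norm_of_nonneg (by positivity), Real.norm_of_nonneg (hF0 r hr'), hηθ r hr']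
      linarith [hθF r hr']) v hv
  rw [Real.norm_of_nonneg (hF0 v hv)] at hgr
  exact (hθF v hv).trans (by gcongr)

/-- Along a solution of an integral equation a measurable field of linear growth is integrable. -/
lemma intervalIntegrable_of_integral_equation {d : ℕ} {f : ℝ → Vec d → Vec d} {θ : ℝ → Vec d}
    {x : Vec d} {s t κ m : ℝ} (hκ : 0 ≤ κ) (hm : 0 ≤ m) (hst : s ≤ t)
    (hf : Measurable (Function.uncurry f))
    (hg : ∀ r ∈ Icc s t, ∀ z, ‖f r z‖ ≤ κ * (m + ‖z‖))
    (hθ : ∀ r ∈ Icc s t, θ r = x + ∫ q in s..r, f q (θ q)) :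
    IntervalIntegrable (fun r => f r (θ r)) volume s t := by
  have hbdd : ∀ {a b : ℝ} (B : ℝ), s ≤ a → a ≤ b → b ≤ t → ContinuousOn θ (Ioo a b) →
      (∀ r ∈ Ioo a b, ‖θ r‖ ≤ B) → IntervalIntegrable (fun r => f r (θ r)) volume a b := by
    intro a b B ha hab hb hc hB
    rw [intervalIntegrable_iff_integrableOn_Ioo_of_le hab]
    refine IntegrableOn.of_bound (C := κ * (m + B)) (by simp) ?_ ?_
    · exact (hf.comp_aemeasurable (aemeasurable_id.prodMk
        (hc.aemeasurable measurableSet_Ioo))).aestronglyMeasurable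
    · refine (ae_restrict_mem measurableSet_Ioo).mono fun r hr => ?_
      refine (hg r ⟨ha.trans hr.1.le, hr.2.le.trans hb⟩ _).trans ?_
      have := hB r hr
      gcongr
  set J := {v | v ∈ Icc s t ∧ IntervalIntegrable (fun r => f r (θ r)) volume s v} with hJ
  have hsJ : s ∈ J := ⟨left_mem_Icc.2 hst, IntervalIntegrable.refl⟩
  have hJb : BddAbove J := ⟨t, fun v hv => hv.1.2⟩
  have hs0 : s ≤ sSup J := le_csSup hJb hsJ
  have h0t : sSup J ≤ t := csSup_le ⟨s, hsJ⟩ fun v hv => hv.1.2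
  have hcJ : ∀ w ∈ J, ContinuousOn θ (Icc s w) := fun w hw => by
    have h := intervalIntegral.continuousOn_primitive_interval
      ((intervalIntegrable_iff_integrableOn_Icc_of_le hw.1.1).1 hw.2 |> fun h => by
        rwa [← uIcc_of_le hw.1.1] at h)
    rw [uIcc_of_le hw.1.1] at h
    refine (continuousOn_const.add h).congr fun r hr => hθ r ⟨hr.1, hr.2.trans hw.1.2⟩
  have hex : ∀ r ∈ Ioo s (sSup J), ∃ w ∈ J, r < w := fun r hr =>
    exists_lt_of_lt_csSup ⟨s, hsJ⟩ hr.2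
  have h1 : IntervalIntegrable (fun r => f r (θ r)) volume s (sSup J) := by
    refine hbdd (‖x‖ + κ * gronwallBound 0 κ (m + ‖x‖) (t - s)) le_rfl hs0 h0t ?_ ?_
    · intro r hr
      obtain ⟨w, hw, hrw⟩ := hex r hr
      exact ((hcJ w hw).continuousAt (Icc_mem_nhds hr.1 hrw)).continuousWithinAt
    · intro r hr
      obtain ⟨w, hw, hrw⟩ := hex r hr
      have hwt := hw.1.2
      refine (norm_le_of_integral_equation hκ hm (fun q hq => hg q ⟨hq.1, hq.2.trans hwt⟩ _)
        (hcJ w hw) (fun q hq => hθ q ⟨hq.1, hq.2.trans hwt⟩) ⟨hr.1.le, hrw.le⟩).trans ?_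
      have := gronwallBound_mono (δ := 0) (K := κ) (ε := m + ‖x‖) le_rfl (by positivity) hκ
        (sub_le_sub_right (hrw.le.trans hwt) s)
      gcongr
  have hx : ∀ r ∈ Ioo (sSup J) t, θ r = x := fun r hr => by
    have hr' : r ∈ Icc s t := ⟨hs0.trans hr.1.le, hr.2.le⟩
    rw [hθ r hr', intervalIntegral.integral_undef, add_zero]
    exact fun h => (le_csSup hJb ⟨hr', h⟩).not_gt hr.1
  refine h1.trans (hbdd ‖x‖ hs0 h0t le_rfl ?_ fun r hr => by rw [hx r hr])
  exact continuousOn_const.congr hx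

/-- The expectation of the barrier does not increase along the mollified flow. -/
lemma integral_barrier_le {d : ℕ} {b : ℝ → Vec d → Vec d}
    {σ : ℝ → Vec d → Matrix (Fin d) (Fin d) ℝ} {κ₀ κ₁ α : ℝ} {ρ : Vec d → ℝ}
    (hκ₀ : 0 ≤ κ₀) (hκ₁ : 0 < κ₁) (hρ : IsMollifier d ρ) (hσ : EllipticHolder d σ κ₀ α)
    (hb : HolderDrift d b κ₁ 0) (hbc : ∀ r, Continuous (b r)) {θ1 : ℝ → ℝ → Vec d → Vec d}
    (hθ1 : IsFlow d (mollifiedDrift d ρ 1 b) θ1) {x : Vec d} {s t : ℝ} (hs : 0 ≤ s) (hst : s < t)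
    {Ω : Type*} [MeasurableSpace Ω] {P : Measure Ω} {X : ℝ → Ω → Vec d}
    (hX : MartingaleProblemSolution d b σ s x P X) {R : ℝ} (hR : 0 ≤ R) :
    ∫ ω, barrier d (6 * κ₁ + d * κ₀ + 2 * κ₀) s R ((t, θ1 t s x), X t ω) ∂P ≤
      cutoffExp R 1 := by
  have := hX.isProb
  set K := 6 * κ₁ + d * κ₀ + 2 * κ₀ with hK
  have hK0 : 0 ≤ K := by positivity
  set θ : ℝ → Vec d := fun r => θ1 r s x with hθdef
  set c : ℝ → Vec d := fun r => mollifiedDrift d ρ 1 b r (θ r) with hcdef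
  have hmol : ∀ r, 0 ≤ r → ∀ z, ‖mollifiedDrift d ρ 1 b r z - b r z‖ ≤ 2 * κ₁ := fun r hr z =>
    norm_mollifiedDrift_sub_le hκ₁ hb hρ hr (hbc r) z
  have hgrow : ∀ r, 0 ≤ r → ∀ z, ‖mollifiedDrift d ρ 1 b r z‖ ≤ κ₁ * (4 + ‖z‖) := by
    intro r hr z
    have h1 := norm_le_norm_add_norm_sub' (mollifiedDrift d ρ 1 b r z) (b r z)
    linarith [hmol r hr z, norm_drift_le hκ₁ hb hr z]
  have hθeq : ∀ r ∈ Icc s t, θ r = x + ∫ q in s..r, c q := fun r hr =>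
    hθ1 s r hs (hs.trans hr.1) x
  have hc : IntervalIntegrable c volume s t :=
    intervalIntegrable_of_integral_equation hκ₁.le (by norm_num) hst.le
      (measurable_mollifiedDrift hb.1 hρ 1) (fun r hr => hgrow r (hs.trans hr.1)) hθeq
  have hcsub : ∀ u v, s ≤ u → u ≤ v → v ≤ t → IntervalIntegrable c volume u v :=
    fun u v hu huv hv => hc.mono_set <| by
      rw [uIcc_of_le huv, uIcc_of_le hst.le]; exact Icc_subset_Icc hu hv
  have hθ : ∀ u v, s ≤ u → u ≤ v → v ≤ t → θ v - θ u = ∫ r in u..v, c r := by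
    intro u v hu huv hv
    rw [hθeq v ⟨hu.trans huv, hv⟩, hθeq u ⟨hu, huv.trans hv⟩, add_sub_add_left_eq_sub,
      intervalIntegral.integral_interval_sub_left (hcsub s v le_rfl (hu.trans huv) hv)
        (hcsub s u le_rfl hu (huv.trans hv))]
  have hθc : ContinuousOn θ (Icc s t) := by
    have h := intervalIntegral.continuousOn_primitive_interval
      ((intervalIntegrable_iff_integrableOn_Icc_of_le hst.le).1 hc |> fun h => by
        rwa [← uIcc_of_le hst.le] at h)
    rw [uIcc_of_le hst.le] at h
    exact (continuousOn_const.add h).congr hθeq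
  obtain ⟨G, hG⟩ := isCompact_Icc.exists_bound_of_continuousOn hθc
  have hB : ∀ r ∈ Icc s t, ‖c r‖ ≤ κ₁ * (4 + G) := fun r hr =>
    (hgrow r (hs.trans hr.1) _).trans (by have := hG r hr; gcongr)
  set B := κ₁ * (4 + G) with hBdef
  have hB0 : 0 ≤ B := (norm_nonneg _).trans (hB s ⟨le_rfl, hst.le⟩)
  have hsub : ∀ u ∈ Ico s t, ∀ᶠ v in 𝓝[>] u, ∀ r ∈ Icc u v, ∀ y,
      paramDeriv (barrier d K s R) ((u, θ u), y) (1, c r) +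
        genApply d b σ r (fun y => barrier d K s R ((u, θ u), y)) y ≤ 0 := by
    intro u hu
    have hlt : u < min t (u + 1 / (B + 1)) :=
      lt_min hu.2 (by linarith [show 0 < 1 / (B + 1) by positivity])
    filter_upwards [Ioo_mem_nhdsGT hlt] with v hv r hr y
    have hvt : v < t := hv.2.trans_le (min_le_left _ _)
    have hvB : v < u + 1 / (B + 1) := hv.2.trans_le (min_le_right _ _)
    have hr0 : 0 ≤ r := hs.trans (hu.1.trans hr.1)
    have hclose : ‖θ r - θ u‖ ≤ 1 := by
      rw [hθ u r hu.1 hr.1 (hr.2.trans hvt.le)]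
      refine (intervalIntegral.norm_integral_le_of_norm_le_const (C := B) fun q hq => ?_).trans ?_
      · rw [uIoc_of_le hr.1] at hq
        exact hB q ⟨hu.1.trans hq.1.le, hq.2.trans (hr.2.trans hvt.le)⟩
      · rw [abs_of_nonneg (sub_nonneg.2 hr.1)]
        have h1 : r - u ≤ 1 / (B + 1) := by linarith [hr.2]
        rw [le_div_iff₀ (by positivity)] at h1
        nlinarith [hr.1]
    refine barrier_supersolution hκ₀ hκ₁.le hσ hr0 (q := (u, θ u)) hu.1 ?_
    have h1 := norm_drift_sub_le hκ₁ hb hr0 y (θ r)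
    have h2 := hmol r hr0 (θ r)
    rw [norm_sub_rev] at h2
    have h3 := norm_sub_le_norm_sub_add_norm_sub (b r y) (b r (θ r)) (c r)
    have h4 := norm_sub_le_norm_sub_add_norm_sub y (θ u) (θ r)
    rw [norm_sub_rev (θ u)] at h4
    have h5 : κ₁ * ‖y - θ r‖ ≤ κ₁ * (‖y - θ u‖ + 1) := by gcongr; linarith
    linarith
  have hmain := integral_le_of_supersolution hσ hκ₁ hb hs hst hX (contDiff_barrier d K s R)
    (hasCompactSupport_barrier d K s R)
    (fun z => abs_cutoffExp_le R (barrierExponent_pos d K s z).le)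
    (norm_paramDeriv_barrier_le hK0 hR) hB hc hθ hsub
  refine hmain.trans (le_of_eq ?_)
  have hθs : θ s = x := by simpa using hθeq s ⟨le_rfl, hst.le⟩
  rw [integral_congr_ae (g := fun _ => cutoffExp R 1)]
  · simp
  · filter_upwards [hX.start] with ω hω
    simp [barrier, barrierExponent, hω, hθs]

lemma stochastic_control_bound_of_barrier {d : ℕ} {Ω : Type*} [MeasurableSpace Ω] {P : Measure Ω}
    [IsProbabilityMeasure P] {Y : Ω → Vec d} (hY : Measurable Y) {K s t T : ℝ} (hK : 0 ≤ K)
    (hT : 0 ≤ T) (htT : t - s ≤ T) {ζ : Vec d}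
    (hbar : ∀ R, 0 ≤ R → ∫ ω, barrier d K s R ((t, ζ), Y ω) ∂P ≤ cutoffExp R 1)
    {ℓ : Vec d → ℝ} (hℓ : ∀ z, 0 < ℓ z) {M : ℝ} (hM : ∀ z, ℓ z ≤ M) :
    ∫ ω, ℓ (Y ω) ∂P ≤ Real.exp 1 * Real.exp (K * T) *
      ⨆ z : Vec d, Real.exp (Real.log (ℓ z) -
        (Real.exp 1 * Real.exp (K * T))⁻¹ * ‖z - ζ‖ ^ 2) := by
  set C := Real.exp 1 * Real.exp (K * T) with hC
  have hC0 : 0 < C := by positivity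
  set S := ⨆ z : Vec d, Real.exp (Real.log (ℓ z) - C⁻¹ * ‖z - ζ‖ ^ 2) with hS
  have hle : ∀ z, Real.exp (Real.log (ℓ z) - C⁻¹ * ‖z - ζ‖ ^ 2) ≤ S := by
    refine fun z => le_ciSup (f := fun z => Real.exp (Real.log (ℓ z) - C⁻¹ * ‖z - ζ‖ ^ 2))
      ⟨M, ?_⟩ z
    rintro _ ⟨y, rfl⟩
    refine le_trans ?_ (hM y)
    exact (Real.exp_le_exp.2 (sub_le_self _ (by positivity))).trans_eq (Real.exp_log (hℓ y))
  have hS0 : 0 < S := (Real.exp_pos _).trans_le (hle 0)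
  have hM0 : 0 < M := (hℓ 0).trans_le (hM 0)
  set R := 1 + max 0 (Real.log (M / S)) with hR
  have hR1 : 1 ≤ R := by linarith [le_max_left 0 (Real.log (M / S))]
  have hMR : M ≤ S * Real.exp (R - 1) := by
    have h1 : M / S ≤ Real.exp (R - 1) := by
      rw [← Real.log_le_iff_le_exp (by positivity)]
      linarith [le_max_right 0 (Real.log (M / S))]
    rwa [div_le_iff₀' hS0] at h1
  have hCe : C⁻¹ ≤ Real.exp (-K * (t - s)) := by
    rw [hC, ← Real.exp_add, ← Real.exp_neg]
    refine Real.exp_le_exp.2 ?_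
    nlinarith
  have hpt : ∀ z, ℓ z ≤ S * (barrier d K s R ((t, ζ), z) - cutoffExp R 0 + 1) := by
    intro z
    refine le_trans ?_ (mul_le_mul_of_nonneg_left
      (min_exp_le_cutoffExp hR1 (barrierExponent_pos d K s ((t, ζ), z)).le) hS0.le)
    rw [mul_min_of_nonneg _ _ hS0.le]
    refine le_min ?_ ((hM z).trans hMR)
    have h1 : ℓ z = Real.exp (Real.log (ℓ z) - C⁻¹ * ‖z - ζ‖ ^ 2) *
        Real.exp (C⁻¹ * ‖z - ζ‖ ^ 2) := by
      rw [← Real.exp_add, sub_add_cancel, Real.exp_log (hℓ z)]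
    rw [h1]
    refine mul_le_mul (hle z) (Real.exp_le_exp.2 ?_) (Real.exp_pos _).le hS0.le
    have h2 : C⁻¹ * ‖z - ζ‖ ^ 2 ≤ Real.exp (-K * (t - s)) * ‖z - ζ‖ ^ 2 := by gcongr
    have h3 := Real.exp_pos (-K * (t - s))
    simp only [barrierExponent]
    linarith
  have hint : Integrable (fun ω => barrier d K s R ((t, ζ), Y ω)) P := by
    refine Integrable.of_bound (Measurable.aestronglyMeasurable ?_) |cutoffExp R 0|
      (Eventually.of_forall fun ω => abs_cutoffExp_le R (barrierExponent_pos d K s _).le)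
    exact (contDiff_barrier d K s R).continuous.measurable.comp (measurable_const.prodMk hY)
  have hint1 : Integrable (fun ω => barrier d K s R ((t, ζ), Y ω) - cutoffExp R 0) P :=
    hint.sub (integrable_const _)
  calc ∫ ω, ℓ (Y ω) ∂P
      ≤ ∫ ω, S * (barrier d K s R ((t, ζ), Y ω) - cutoffExp R 0 + 1) ∂P :=
        integral_mono_of_nonneg (Eventually.of_forall fun ω => (hℓ _).le)
          ((hint1.add (integrable_const _)).const_mul _) (Eventually.of_forall fun ω => hpt _)
    _ = S * (∫ ω, barrier d K s R ((t, ζ), Y ω) ∂P - cutoffExp R 0 + 1) := by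
        rw [integral_const_mul, integral_add hint1 (integrable_const _),
          integral_sub hint (integrable_const _)]
        simp
    _ ≤ S * (cutoffExp R 1 - cutoffExp R 0 + 1) := by
        have := hbar R (by linarith)
        gcongr
    _ ≤ S * Real.exp 1 := by gcongr; exact cutoffExp_sub_zero_le R zero_le_one
    _ ≤ S * C := by
        gcongr
        exact le_mul_of_one_le_right (Real.exp_pos _).le (Real.one_le_exp (by positivity))
    _ = C * S := mul_comm _ _

/-- **Stochastic-control expectation bound.** Under (H^σ_α) and (H^b_0),
with `b, σ` smooth in space with bounded derivatives of every order, for any `T > 0` there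
is `C > 0`, depending only on `Θ = (T,α,0,κ₀,κ₁,d)`, such that for every bounded-above and
bounded-below measurable `ℓ : ℝ^d → (0,∞)`, every `x`, every `(s,t) ∈ 𝔻^T_0` and every
solution of the martingale problem for `(b,σ)` started at `(s,x)`,
`E[ℓ(X_t)] ≤ C sup_z exp(ln ℓ(z) − C⁻¹|z − θ^{(1)}_{t,s}(x)|²)`. -/
theorem stochastic_control_expectation_bound
    (d : ℕ) (T α κ₀ κ₁ : ℝ) (hT : 0 < T) (hα : α ∈ Set.Ioc (0 : ℝ) 1)
    (hκ₀ : 1 ≤ κ₀) (hκ₁ : 0 < κ₁) (ρ : Vec d → ℝ) (hρ : IsMollifier d ρ) :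
    ∃ C > (0 : ℝ),
      ∀ (b : ℝ → Vec d → Vec d) (σ : ℝ → Vec d → Matrix (Fin d) (Fin d) ℝ)
        (θ1 : ℝ → ℝ → Vec d → Vec d),
        EllipticHolder d σ κ₀ α → HolderDrift d b κ₁ 0 →
        SmoothVecBounded d b → SmoothMatBounded d σ →
        IsFlow d (mollifiedDrift d ρ 1 b) θ1 →
      ∀ ℓ : Vec d → ℝ, Measurable ℓ → (∃ m > (0 : ℝ), ∀ z : Vec d, m ≤ ℓ z) →
        (∃ M : ℝ, ∀ z : Vec d, ℓ z ≤ M) →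
      ∀ (x : Vec d) (s t : ℝ), 0 ≤ s → s < t → t - s < T →
      ∀ (Ω : Type) (mΩ : MeasurableSpace Ω)
        (P : MeasureTheory.Measure Ω) (X : ℝ → Ω → Vec d),
        MartingaleProblemSolution d b σ s x P X →
        (∫ ω, ℓ (X t ω) ∂P) ≤
          C * ⨆ z : Vec d, Real.exp (Real.log (ℓ z) - C⁻¹ * ‖z - θ1 t s x‖ ^ 2) := by
  refine ⟨Real.exp 1 * Real.exp ((6 * κ₁ + d * κ₀ + 2 * κ₀) * T), by positivity, ?_⟩
  rintro b σ θ1 hσ hb hbs - hθ1 ℓ - ⟨m, hm, hmℓ⟩ ⟨M, hM⟩ x s t hs hst htT Ω mΩ P X hX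
  have hκ₀' : 0 ≤ κ₀ := zero_le_one.trans hκ₀
  have := hX.isProb
  exact stochastic_control_bound_of_barrier (hX.measurable_X t) (by positivity) hT.le htT.le
    (fun R hR => integral_barrier_le hκ₀' hκ₁ hρ hσ hb (fun r => (hbs.1 r).continuous) hθ1 hs hst
      hX hR) (fun z => hm.trans_le (hmℓ z)) hM
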